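/- arXiv:quant-ph/0403167 — 3 statements merged into one kernel-verified Lean document; each statement's English description precedes it below -/
import Mathlib

section
/- Let ρ be a density matrix on ℂ^d and {P_i} a finite family of mutually orthogonal orthogonal projectors on ℂ^d with ∑_i P_i = 1. Then S(∑_i P_i ρ P_i) ≥ S(ρ), and equality S(∑_i P_i ρ P_i) = S(ρ) holds if and only if every P_i commutes with ρ. -/
open Matrix Kronecker
open scoped ComplexOrder

noncomputable section

/-- von Neumann entropy (natural logarithm): `S(ρ) = -∑ λ_k log λ_k`. -/
def vnEntropy {d : ℕ} (ρ : Matrix (Fin d) (Fin d) ℂ) : ℝ :=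
  if h : ρ.IsHermitian then -∑ k, h.eigenvalues k * Real.log (h.eigenvalues k) else 0

/-- von Neumann entropy in bits (log base 2). -/
def vnEntropy2 {d : ℕ} (ρ : Matrix (Fin d) (Fin d) ℂ) : ℝ :=
  if h : ρ.IsHermitian then -∑ k, h.eigenvalues k * Real.logb 2 (h.eigenvalues k) else 0

/-- A density matrix: positive semidefinite with unit trace. -/
def IsDensityMatrix {n : Type} [Fintype n] [DecidableEq n] (ρ : Matrix n n ℂ) : Prop :=
  ρ.PosSemidef ∧ ρ.trace = 1

/-- Partial trace over the B system. -/
def ptraceB {dA dB : ℕ} (ρ : Matrix (Fin dA × Fin dB) (Fin dA × Fin dB) ℂ) :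
    Matrix (Fin dA) (Fin dA) ℂ :=
  Matrix.of fun a a' => ∑ b, ρ (a, b) (a', b)

/-- Partial trace over the A system. -/
def ptraceA {dA dB : ℕ} (ρ : Matrix (Fin dA × Fin dB) (Fin dA × Fin dB) ℂ) :
    Matrix (Fin dB) (Fin dB) ℂ :=
  Matrix.of fun b b' => ∑ a, ρ (a, b) (a, b')

/-- A projective measurement on `ℂ^{dA}`: a finite family of mutually orthogonal
orthogonal projectors summing to the identity. -/
structure ProjMeas (dA m : ℕ) where
  P : Fin m → Matrix (Fin dA) (Fin dA) ℂ
  herm : ∀ i, (P i).IsHermitian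
  idem : ∀ i, P i * P i = P i
  orth : ∀ i j, i ≠ j → P i * P j = 0
  sum_eq : ∑ i, P i = 1

/-- A measurement is complete if all projectors are rank one. -/
def ProjMeas.Complete {dA m : ℕ} (M : ProjMeas dA m) : Prop :=
  ∀ i, (M.P i).rank = 1

/-- Outcome probability `p_i = Tr[(P_i ⊗ 1) ρ]`. -/
def prob {dA dB m : ℕ} (ρ : Matrix (Fin dA × Fin dB) (Fin dA × Fin dB) ℂ)
    (M : ProjMeas dA m) (i : Fin m) : ℝ :=
  (((M.P i ⊗ₖ (1 : Matrix (Fin dB) (Fin dB) ℂ)) * ρ).trace).re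

/-- Conditional state of Bob: `Tr_A[(P_i ⊗ 1) ρ (P_i ⊗ 1)] / p_i`. -/
def condB {dA dB m : ℕ} (ρ : Matrix (Fin dA × Fin dB) (Fin dA × Fin dB) ℂ)
    (M : ProjMeas dA m) (i : Fin m) : Matrix (Fin dB) (Fin dB) ℂ :=
  ((prob ρ M i : ℂ))⁻¹ •
    ptraceA ((M.P i ⊗ₖ (1 : Matrix (Fin dB) (Fin dB) ℂ)) * ρ *
      (M.P i ⊗ₖ (1 : Matrix (Fin dB) (Fin dB) ℂ)))

/-- `c_HV(ρ,{P_i}) = S(ρ_B) - ∑_i p_i S(ρ_i^B)`. -/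
def cHV {dA dB m : ℕ} (ρ : Matrix (Fin dA × Fin dB) (Fin dA × Fin dB) ℂ)
    (M : ProjMeas dA m) : ℝ :=
  vnEntropy (ptraceA ρ) - ∑ i, prob ρ M i * vnEntropy (condB ρ M i)

/-- Same, in bits. -/
def cHV2 {dA dB m : ℕ} (ρ : Matrix (Fin dA × Fin dB) (Fin dA × Fin dB) ℂ)
    (M : ProjMeas dA m) : ℝ :=
  vnEntropy2 (ptraceA ρ) - ∑ i, prob ρ M i * vnEntropy2 (condB ρ M i)

/-- Dephasing of a single-system state: `∑_i P_i σ P_i`. -/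
def deph {d m : ℕ} (σ : Matrix (Fin d) (Fin d) ℂ) (M : ProjMeas d m) :
    Matrix (Fin d) (Fin d) ℂ :=
  ∑ i, M.P i * σ * M.P i

/-- `δ_cl^→(ρ,{P_i}) = S(ρ_A) - S(ρ'_A) + c_HV(ρ,{P_i})`. -/
def deltaCl {dA dB m : ℕ} (ρ : Matrix (Fin dA × Fin dB) (Fin dA × Fin dB) ℂ)
    (M : ProjMeas dA m) : ℝ :=
  vnEntropy (ptraceB ρ) - vnEntropy (deph (ptraceB ρ) M) + cHV ρ M

/-- The Henderson–Vedral quantity: supremum of `c_HV` over complete projective measurements. -/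
def CHV {dA dB : ℕ} (ρ : Matrix (Fin dA × Fin dB) (Fin dA × Fin dB) ℂ) : ℝ :=
  sSup {x : ℝ | ∃ m, ∃ M : ProjMeas dA m, M.Complete ∧ x = cHV ρ M}

/-- One-way classical information deficit: supremum of `δ_cl^→` over complete
projective measurements. -/
def DeltaCl {dA dB : ℕ} (ρ : Matrix (Fin dA × Fin dB) (Fin dA × Fin dB) ℂ) : ℝ :=
  sSup {x : ℝ | ∃ m, ∃ M : ProjMeas dA m, M.Complete ∧ x = deltaCl ρ M}

/-- Alice-side dephasing of a bipartite state: `∑_i (P_i ⊗ 1) ρ (P_i ⊗ 1)`. -/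
def dephAB {dA dB m : ℕ} (ρ : Matrix (Fin dA × Fin dB) (Fin dA × Fin dB) ℂ)
    (M : ProjMeas dA m) : Matrix (Fin dA × Fin dB) (Fin dA × Fin dB) ℂ :=
  ∑ i, (M.P i ⊗ₖ (1 : Matrix (Fin dB) (Fin dB) ℂ)) * ρ *
    (M.P i ⊗ₖ (1 : Matrix (Fin dB) (Fin dB) ℂ))

/-- Outer product `|v⟩⟨v|`. -/
def outer {n : Type} [Fintype n] (v : n → ℂ) : Matrix n n ℂ :=
  Matrix.of fun x y => v x * star (v y)

/-- The scalar form of Klein's inequality. -/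
theorem mul_log_sub_mul_log_sub_add_nonneg {x y : ℝ} (hx : 0 ≤ x) (hy : 0 < y) :
    0 ≤ x * Real.log x - x * Real.log y - x + y := by
  rcases hx.eq_or_lt with rfl | hx
  · simpa using hy.le
  have h := Real.log_le_sub_one_of_pos (div_pos hy hx)
  rw [Real.log_div hy.ne' hx.ne'] at h
  have h' := mul_le_mul_of_nonneg_left h hx.le
  have : x * (y / x - 1) = y - x := by field_simp
  linarith

theorem eq_of_mul_log_sub_mul_log_sub_add_eq_zero {x y : ℝ} (hx : 0 ≤ x) (hy : 0 < y)
    (h : x * Real.log x - x * Real.log y - x + y = 0) : x = y := by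
  rcases hx.eq_or_lt with rfl | hx
  · simpa using h.symm
  by_contra hne
  have h1 := Real.log_lt_sub_one_of_pos (div_pos hy hx)
    (fun h1 => hne ((div_eq_one_iff_eq hx.ne').1 h1).symm)
  rw [Real.log_div hy.ne' hx.ne'] at h1
  have h' := mul_lt_mul_of_pos_left h1 hx
  have : x * (y / x - 1) = y - x := by field_simp
  linarith

/-- Klein's inequality for spectra related by a doubly stochastic overlap matrix `c`, under the
assumption that both spectra give the same averages of functions of `a`. -/
theorem sum_negMulLog_le_of_overlap {n : Type*} [Fintype n] {a b : n → ℝ} {c : n → n → ℝ}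
    (ha : ∀ j, 0 ≤ a j) (hb : ∀ k, 0 ≤ b k) (hc : ∀ j k, 0 ≤ c j k)
    (hrow : ∀ j, ∑ k, c j k = 1) (hcol : ∀ k, ∑ j, c j k = 1)
    (h : ∀ f : ℝ → ℝ, ∑ j, ∑ k, c j k * f (a j) * b k = ∑ j, f (a j) * a j) :
    ∑ k, (b k).negMulLog ≤ ∑ j, (a j).negMulLog ∧
      (∑ j, (a j).negMulLog = ∑ k, (b k).negMulLog → ∀ j k, c j k = 0 ∨ a j = b k) := by
  have hker : ∀ j k, a j = 0 → c j k * b k = 0 := by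
    intro j k hj
    have h0 := h (fun x => if x = 0 then 1 else 0)
    have hR : ∑ j, (if a j = 0 then (1 : ℝ) else 0) * a j = 0 :=
      Finset.sum_eq_zero fun j _ => by split_ifs with h <;> simp [h]
    have hnn : ∀ j k, 0 ≤ c j k * (if a j = 0 then (1 : ℝ) else 0) * b k := fun j k =>
      mul_nonneg (mul_nonneg (hc j k) (by split_ifs <;> norm_num)) (hb k)
    rw [hR, Finset.sum_eq_zero_iff_of_nonneg fun j _ => Finset.sum_nonneg fun k _ => hnn j k] at h0
    have h1 := h0 j (Finset.mem_univ j)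
    rw [Finset.sum_eq_zero_iff_of_nonneg fun k _ => hnn j k] at h1
    simpa [hj] using h1 k (Finset.mem_univ k)
  set g : n → n → ℝ := fun j k =>
    c j k * (b k * Real.log (b k) - b k * Real.log (a j) - b k + a j) with hg
  have hg0 : ∀ j k, 0 ≤ g j k := by
    intro j k
    rcases (ha j).eq_or_lt with hj | hj
    · have : g j k = (c j k * b k) * (Real.log (b k) - 1) := by
        simp only [hg, ← hj, Real.log_zero]
        ring
      simp [this, hker j k hj.symm]
    · exact mul_nonneg (hc j k) (mul_log_sub_mul_log_sub_add_nonneg (hb k) hj)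
  have hsum : ∑ j, ∑ k, g j k = ∑ j, (a j).negMulLog - ∑ k, (b k).negMulLog := by
    have hcb : ∀ u : n → ℝ, ∑ j, ∑ k, c j k * u k = ∑ k, u k := fun u => by
      rw [Finset.sum_comm]
      simp [← Finset.sum_mul, hcol]
    have hca : ∑ j, ∑ k, c j k * a j = ∑ j, a j := by
      simp [← Finset.sum_mul, hrow]
    have h1 := h fun _ => 1
    simp only [mul_one, one_mul, hcb] at h1
    have e : ∀ j k, g j k = c j k * (b k * Real.log (b k)) - c j k * Real.log (a j) * b k
        - c j k * b k + c j k * a j := fun j k => by simp only [hg]; ring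
    simp only [e, Finset.sum_add_distrib, Finset.sum_sub_distrib, hcb, hca, h Real.log, h1,
      Real.negMulLog, neg_mul, Finset.sum_neg_distrib, mul_comm (Real.log _)]
    ring
  refine ⟨?_, fun heq j k => ?_⟩
  · have := Finset.sum_nonneg fun j (_ : j ∈ Finset.univ) =>
      Finset.sum_nonneg fun k (_ : k ∈ Finset.univ) => hg0 j k
    linarith
  · rw [heq, sub_self, Finset.sum_eq_zero_iff_of_nonneg fun j _ =>
      Finset.sum_nonneg fun k _ => hg0 j k] at hsum
    have h1 := hsum j (Finset.mem_univ j)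
    rw [Finset.sum_eq_zero_iff_of_nonneg fun k _ => hg0 j k] at h1
    rcases mul_eq_zero.1 (h1 k (Finset.mem_univ k)) with hz | hz
    · exact Or.inl hz
    · rcases (ha j).eq_or_lt with hj | hj
      · rcases mul_eq_zero.1 (hker j k hj.symm) with h2 | h2
        · exact Or.inl h2
        · exact Or.inr (by rw [← hj, h2])
      · exact Or.inr (eq_of_mul_log_sub_mul_log_sub_add_eq_zero (hb k) hj hz).symm

namespace Matrix

variable {n : Type*} [Fintype n] [DecidableEq n]

theorem sum_normSq_row_of_mem_unitaryGroup {W : Matrix n n ℂ} (hW : W ∈ unitaryGroup n ℂ) (j : n) :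
    ∑ k, Complex.normSq (W j k) = 1 := by
  have h := congrFun (congrFun (mem_unitaryGroup_iff.1 hW) j) j
  simp only [mul_apply, star_apply, one_apply_eq, RCLike.star_def, Complex.mul_conj] at h
  exact_mod_cast h

theorem sum_normSq_col_of_mem_unitaryGroup {W : Matrix n n ℂ} (hW : W ∈ unitaryGroup n ℂ) (k : n) :
    ∑ j, Complex.normSq (W j k) = 1 := by
  simpa [star_apply, Complex.normSq_conj] using
    sum_normSq_row_of_mem_unitaryGroup (Unitary.star_mem hW) k

theorem trace_diagonal_mul_conj_diagonal (W : Matrix n n ℂ) (x y : n → ℂ) :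
    (diagonal x * (W * diagonal y * star W)).trace =
      ∑ j, ∑ k, Complex.normSq (W j k) * x j * y k := by
  simp only [trace, diag_apply, diagonal_mul]
  refine Finset.sum_congr rfl fun j _ => ?_
  rw [mul_apply, Finset.mul_sum]
  refine Finset.sum_congr rfl fun k _ => ?_
  rw [mul_diagonal, star_apply, RCLike.star_def, ← Complex.mul_conj]
  ring

theorem IsHermitian.eq_unitary_conj_diagonal {A : Matrix n n ℂ} (hA : A.IsHermitian) :
    A = (hA.eigenvectorUnitary : Matrix n n ℂ) * diagonal (fun k => (hA.eigenvalues k : ℂ)) *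
      star (hA.eigenvectorUnitary : Matrix n n ℂ) := by
  conv_lhs => rw [hA.spectral_theorem, Unitary.conjStarAlgAut_apply]
  rfl

theorem IsHermitian.cfc_eq_unitary_conj_diagonal {A : Matrix n n ℂ} (hA : A.IsHermitian)
    (f : ℝ → ℝ) :
    cfc f A = (hA.eigenvectorUnitary : Matrix n n ℂ) *
      diagonal (fun k => (f (hA.eigenvalues k) : ℂ)) *
        star (hA.eigenvectorUnitary : Matrix n n ℂ) := by
  rw [hA.cfc_eq, IsHermitian.cfc, Unitary.conjStarAlgAut_apply]
  rfl

theorem IsHermitian.trace_cfc_mul_self {A : Matrix n n ℂ} (hA : A.IsHermitian) (f : ℝ → ℝ) :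
    (cfc f A * A).trace = ((∑ j, f (hA.eigenvalues j) * hA.eigenvalues j : ℝ) : ℂ) := by
  have h1 : star (hA.eigenvectorUnitary : Matrix n n ℂ) * hA.eigenvectorUnitary = 1 :=
    Unitary.coe_star_mul_self _
  conv_lhs =>
    rw [hA.cfc_eq_unitary_conj_diagonal]
    arg 1
    arg 2
    rw [hA.eq_unitary_conj_diagonal]
  rw [mul_assoc _ (star _), ← mul_assoc (star _), ← mul_assoc (star _), h1, one_mul, mul_assoc,
    trace_mul_comm, mul_assoc, mul_assoc, h1, mul_one, diagonal_mul_diagonal, trace_diagonal]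
  push_cast
  rfl

theorem IsHermitian.trace_cfc_mul {A B : Matrix n n ℂ} (hA : A.IsHermitian) (hB : B.IsHermitian)
    (f : ℝ → ℝ) :
    (cfc f A * B).trace = ((∑ j, ∑ k, Complex.normSq
      ((star (hA.eigenvectorUnitary : Matrix n n ℂ) * hB.eigenvectorUnitary) j k) *
        f (hA.eigenvalues j) * hB.eigenvalues k : ℝ) : ℂ) := by
  push_cast
  rw [← trace_diagonal_mul_conj_diagonal, hA.cfc_eq_unitary_conj_diagonal]
  conv_lhs =>
    arg 1
    arg 2
    rw [hB.eq_unitary_conj_diagonal]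
  rw [star_mul, star_star, mul_assoc, mul_assoc, trace_mul_comm]
  simp only [mul_assoc]

/-- If `A` and `B` have the same expectation for every function of `A`, then `A` has at least the
entropy of `B`, with equality only if `A = B`. -/
theorem PosSemidef.sum_negMulLog_eigenvalues_le {A B : Matrix n n ℂ}
    (hA : A.PosSemidef) (hB : B.PosSemidef)
    (h : ∀ f : ℝ → ℝ, (cfc f A * B).trace = (cfc f A * A).trace) :
    ∑ k, (hB.isHermitian.eigenvalues k).negMulLog ≤ ∑ j, (hA.isHermitian.eigenvalues j).negMulLog ∧
      (∑ j, (hA.isHermitian.eigenvalues j).negMulLog =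
        ∑ k, (hB.isHermitian.eigenvalues k).negMulLog → A = B) := by
  set U := (hA.isHermitian.eigenvectorUnitary : Matrix n n ℂ) with hU
  set V := (hB.isHermitian.eigenvectorUnitary : Matrix n n ℂ) with hV
  have hUU : U * star U = 1 := Unitary.coe_mul_star_self _
  have hVV : V * star V = 1 := Unitary.coe_mul_star_self _
  have hW : star U * V ∈ unitaryGroup n ℂ :=
    mul_mem (Unitary.star_mem hA.isHermitian.eigenvectorUnitary.2)
      hB.isHermitian.eigenvectorUnitary.2
  obtain ⟨hle, heq⟩ := sum_negMulLog_le_of_overlap hA.eigenvalues_nonneg hB.eigenvalues_nonneg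
    (c := fun j k => Complex.normSq ((star U * V) j k)) (fun _ _ => Complex.normSq_nonneg _)
    (sum_normSq_row_of_mem_unitaryGroup hW) (sum_normSq_col_of_mem_unitaryGroup hW)
    (fun f => by
      have := h f
      rw [hA.isHermitian.trace_cfc_mul_self, hA.isHermitian.trace_cfc_mul hB.isHermitian] at this
      exact_mod_cast this)
  refine ⟨hle, fun he => ?_⟩
  have hint : diagonal (fun j => (hA.isHermitian.eigenvalues j : ℂ)) * (star U * V) =
      (star U * V) * diagonal (fun k => (hB.isHermitian.eigenvalues k : ℂ)) := by
    ext j k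
    rw [diagonal_mul, mul_diagonal]
    rcases heq he j k with h0 | h0
    · simp [Complex.normSq_eq_zero.1 h0]
    · rw [h0, mul_comm]
  calc A = U * (diagonal (fun j => (hA.isHermitian.eigenvalues j : ℂ)) * (star U * V)) * star V := by
        conv_lhs => rw [hA.isHermitian.eq_unitary_conj_diagonal]
        simp only [mul_assoc, hVV, mul_one, ← hU]
    _ = B := by
        conv_rhs => rw [hB.isHermitian.eq_unitary_conj_diagonal]
        rw [hint]
        simp only [← mul_assoc, hUU, one_mul, ← hV]

end Matrix

theorem vnEntropy_eq_sum_negMulLog {d : ℕ} {ρ : Matrix (Fin d) (Fin d) ℂ} (h : ρ.IsHermitian) :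
    vnEntropy ρ = ∑ k, (h.eigenvalues k).negMulLog := by
  simp [vnEntropy, h, Real.negMulLog]

theorem posSemidef_deph {d m : ℕ} {ρ : Matrix (Fin d) (Fin d) ℂ} (hρ : ρ.PosSemidef)
    (M : ProjMeas d m) : (deph ρ M).PosSemidef :=
  Matrix.posSemidef_sum _ fun i _ => by
    simpa only [(M.herm i).eq] using hρ.mul_mul_conjTranspose_same (M.P i)

theorem proj_mul_deph {d m : ℕ} (ρ : Matrix (Fin d) (Fin d) ℂ) (M : ProjMeas d m) (i : Fin m) :
    M.P i * deph ρ M = M.P i * ρ * M.P i := by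
  rw [deph, Finset.mul_sum, Finset.sum_eq_single i]
  · rw [← mul_assoc, ← mul_assoc, M.idem]
  · intro j _ hj
    rw [← mul_assoc, ← mul_assoc, M.orth i j hj.symm, zero_mul, zero_mul]
  · simp

theorem deph_mul_proj {d m : ℕ} (ρ : Matrix (Fin d) (Fin d) ℂ) (M : ProjMeas d m) (i : Fin m) :
    deph ρ M * M.P i = M.P i * ρ * M.P i := by
  rw [deph, Finset.sum_mul, Finset.sum_eq_single i]
  · rw [mul_assoc, M.idem]
  · intro j _ hj
    rw [mul_assoc, M.orth j i hj, mul_zero]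
  · simp

theorem commute_proj_deph {d m : ℕ} (ρ : Matrix (Fin d) (Fin d) ℂ) (M : ProjMeas d m)
    (i : Fin m) : Commute (M.P i) (deph ρ M) :=
  (proj_mul_deph ρ M i).trans (deph_mul_proj ρ M i).symm

/-- Dephasing leaves the expectation of every observable commuting with the projectors unchanged. -/
theorem trace_mul_deph_of_commute {d m : ℕ} (ρ : Matrix (Fin d) (Fin d) ℂ) (M : ProjMeas d m)
    {X : Matrix (Fin d) (Fin d) ℂ} (hX : ∀ i, Commute (M.P i) X) :
    (X * deph ρ M).trace = (X * ρ).trace := by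
  have h : ∀ i, (X * (M.P i * ρ * M.P i)).trace = (X * (M.P i * ρ)).trace := fun i => by
    rw [← mul_assoc, trace_mul_comm, ← mul_assoc, (hX i).eq, ← mul_assoc, mul_assoc X, M.idem,
      mul_assoc]
  rw [deph, Finset.mul_sum, trace_sum, Finset.sum_congr rfl fun i _ => h i, ← trace_sum,
    ← Finset.mul_sum, ← Finset.sum_mul, M.sum_eq, one_mul]

theorem deph_eq_self_of_commute {d m : ℕ} {ρ : Matrix (Fin d) (Fin d) ℂ} {M : ProjMeas d m}
    (h : ∀ i, M.P i * ρ = ρ * M.P i) : deph ρ M = ρ := by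
  simp_rw [deph, h, mul_assoc, M.idem]
  rw [← Finset.mul_sum, M.sum_eq, mul_one]

/-- dephasing does not decrease von Neumann entropy, with equality
iff all projectors commute with the state. -/
theorem entropy_deph_ge_and_eq_iff_commute {d m : ℕ}
    (ρ : Matrix (Fin d) (Fin d) ℂ) (hρ : IsDensityMatrix ρ) (M : ProjMeas d m) :
    vnEntropy (deph ρ M) ≥ vnEntropy ρ ∧
      (vnEntropy (deph ρ M) = vnEntropy ρ ↔ ∀ i, M.P i * ρ = ρ * M.P i) := by
  have hσ := posSemidef_deph hρ.1 M
  obtain ⟨hle, heq⟩ := hσ.sum_negMulLog_eigenvalues_le hρ.1 fun f =>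
    (trace_mul_deph_of_commute ρ M fun i =>
      ((commute_proj_deph ρ M i).symm.cfc_real f).symm).symm
  rw [← vnEntropy_eq_sum_negMulLog, ← vnEntropy_eq_sum_negMulLog] at hle heq
  refine ⟨hle, fun h i => ?_, fun h => by rw [deph_eq_self_of_commute h]⟩
  rw [← heq h]
  exact (commute_proj_deph ρ M i).eq

end
end

section
/- Let ρ_AB be a bipartite density matrix and suppose the complete projective measurement {P_i} attains C_HV(ρ_AB), i.e. c_HV(ρ_AB,{P_i}) = C_HV(ρ_AB). Let ρ'_AB = ∑_i (P_i ⊗ 1) ρ_AB (P_i ⊗ 1). Then C_HV(ρ'_AB) ≥ C_HV(ρ_AB). -/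
open Matrix Kronecker
open scoped ComplexOrder

noncomputable section

section

variable {dA dB m : ℕ}

/-- The partial trace over `A` is cyclic with respect to operators acting on `A` alone. -/
theorem ptraceA_kronecker_one_mul_comm (A : Matrix (Fin dA) (Fin dA) ℂ)
    (X : Matrix (Fin dA × Fin dB) (Fin dA × Fin dB) ℂ) :
    ptraceA ((A ⊗ₖ (1 : Matrix (Fin dB) (Fin dB) ℂ)) * X) =
      ptraceA (X * (A ⊗ₖ (1 : Matrix (Fin dB) (Fin dB) ℂ))) := by
  ext b b'
  simp only [ptraceA, Matrix.of_apply, Matrix.mul_apply, Fintype.sum_prod_type,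
    Matrix.kroneckerMap_apply, Matrix.one_apply, mul_ite, mul_one, mul_zero, ite_mul, zero_mul,
    Finset.sum_ite_eq, Finset.sum_ite_eq', Finset.mem_univ, if_true]
  rw [Finset.sum_comm]
  simp only [mul_comm]

theorem ptraceA_sum {ι : Type*} (s : Finset ι)
    (X : ι → Matrix (Fin dA × Fin dB) (Fin dA × Fin dB) ℂ) :
    ptraceA (∑ i ∈ s, X i) = ∑ i ∈ s, ptraceA (X i) := by
  ext b b'
  simp only [ptraceA, Matrix.of_apply, Matrix.sum_apply]
  exact Finset.sum_comm

theorem trace_ptraceA (X : Matrix (Fin dA × Fin dB) (Fin dA × Fin dB) ℂ) :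
    (ptraceA X).trace = X.trace := by
  simp only [ptraceA, Matrix.trace, Matrix.diag_apply, Matrix.of_apply, Fintype.sum_prod_type]
  exact Finset.sum_comm

theorem posSemidef_ptraceA {X : Matrix (Fin dA × Fin dB) (Fin dA × Fin dB) ℂ}
    (hX : X.PosSemidef) : (ptraceA X).PosSemidef := by
  have h : ptraceA X = ∑ a, X.submatrix (fun b => (a, b)) (fun b => (a, b)) := by
    ext b b'
    simp [ptraceA, Matrix.sum_apply]
  rw [h]
  exact Matrix.posSemidef_sum _ fun a _ => hX.submatrix _

namespace ProjMeas

variable (M : ProjMeas dA m) (ρ : Matrix (Fin dA × Fin dB) (Fin dA × Fin dB) ℂ)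

theorem kronecker_one_mul_self (i : Fin m) :
    (M.P i ⊗ₖ (1 : Matrix (Fin dB) (Fin dB) ℂ)) * (M.P i ⊗ₖ (1 : Matrix (Fin dB) (Fin dB) ℂ)) =
      M.P i ⊗ₖ (1 : Matrix (Fin dB) (Fin dB) ℂ) := by
  rw [← Matrix.mul_kronecker_mul, M.idem, one_mul]

theorem kronecker_one_mul_of_ne {i j : Fin m} (h : i ≠ j) :
    (M.P i ⊗ₖ (1 : Matrix (Fin dB) (Fin dB) ℂ)) * (M.P j ⊗ₖ (1 : Matrix (Fin dB) (Fin dB) ℂ)) =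
      0 := by
  rw [← Matrix.mul_kronecker_mul, M.orth i j h, Matrix.zero_kronecker]

theorem sum_kronecker_one :
    ∑ i, M.P i ⊗ₖ (1 : Matrix (Fin dB) (Fin dB) ℂ) = 1 := by
  rw [← Matrix.one_kronecker_one, ← M.sum_eq]
  ext x y
  simp [Matrix.sum_apply, Finset.sum_mul]

theorem conjTranspose_kronecker_one (i : Fin m) :
    (M.P i ⊗ₖ (1 : Matrix (Fin dB) (Fin dB) ℂ))ᴴ = M.P i ⊗ₖ (1 : Matrix (Fin dB) (Fin dB) ℂ) := by
  rw [Matrix.conjTranspose_kronecker, (M.herm i).eq, Matrix.conjTranspose_one]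

variable {ρ} in
theorem posSemidef_conj (hρ : ρ.PosSemidef) (i : Fin m) :
    ((M.P i ⊗ₖ (1 : Matrix (Fin dB) (Fin dB) ℂ)) * ρ *
      (M.P i ⊗ₖ (1 : Matrix (Fin dB) (Fin dB) ℂ))).PosSemidef := by
  simpa only [conjTranspose_kronecker_one] using
    hρ.mul_mul_conjTranspose_same (M.P i ⊗ₖ (1 : Matrix (Fin dB) (Fin dB) ℂ))

theorem trace_conj (i : Fin m) :
    ((M.P i ⊗ₖ (1 : Matrix (Fin dB) (Fin dB) ℂ)) * ρ *
      (M.P i ⊗ₖ (1 : Matrix (Fin dB) (Fin dB) ℂ))).trace =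
      ((M.P i ⊗ₖ (1 : Matrix (Fin dB) (Fin dB) ℂ)) * ρ).trace := by
  rw [Matrix.trace_mul_comm, ← mul_assoc, kronecker_one_mul_self]

/-- Dephasing does not change the unnormalized post-measurement states. -/
theorem conj_dephAB (j : Fin m) :
    (M.P j ⊗ₖ (1 : Matrix (Fin dB) (Fin dB) ℂ)) * dephAB ρ M *
      (M.P j ⊗ₖ (1 : Matrix (Fin dB) (Fin dB) ℂ)) =
    (M.P j ⊗ₖ (1 : Matrix (Fin dB) (Fin dB) ℂ)) * ρ *
      (M.P j ⊗ₖ (1 : Matrix (Fin dB) (Fin dB) ℂ)) := by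
  rw [dephAB, Finset.mul_sum, Finset.sum_mul, Finset.sum_eq_single j]
  · rw [mul_assoc, mul_assoc (_ * ρ), kronecker_one_mul_self, ← mul_assoc, ← mul_assoc,
      kronecker_one_mul_self]
  · intro i _ hi
    rw [← mul_assoc, ← mul_assoc, kronecker_one_mul_of_ne M hi.symm]
    simp
  · simp

theorem ptraceA_dephAB : ptraceA (dephAB ρ M) = ptraceA ρ := by
  simp only [dephAB, ptraceA_sum, mul_assoc, ptraceA_kronecker_one_mul_comm,
    kronecker_one_mul_self]
  rw [← ptraceA_sum, ← Finset.mul_sum, sum_kronecker_one, mul_one]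

theorem prob_dephAB (i : Fin m) : prob (dephAB ρ M) M i = prob ρ M i := by
  rw [prob, ← trace_conj, conj_dephAB, trace_conj, prob]

theorem condB_dephAB (i : Fin m) : condB (dephAB ρ M) M i = condB ρ M i := by
  rw [condB, conj_dephAB, prob_dephAB, condB]

theorem cHV_dephAB : cHV (dephAB ρ M) M = cHV ρ M := by
  simp only [cHV, ptraceA_dephAB, prob_dephAB, condB_dephAB]

variable {ρ}

theorem posSemidef_dephAB (hρ : ρ.PosSemidef) : (dephAB ρ M).PosSemidef :=
  Matrix.posSemidef_sum _ fun i _ => M.posSemidef_conj hρ i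

theorem prob_nonneg (hρ : ρ.PosSemidef) (i : Fin m) : 0 ≤ prob ρ M i := by
  rw [prob, ← trace_conj]
  exact (Complex.nonneg_iff.mp (M.posSemidef_conj hρ i).trace_nonneg).1

theorem isDensityMatrix_condB (hρ : ρ.PosSemidef) {i : Fin m} (hi : prob ρ M i ≠ 0) :
    IsDensityMatrix (condB ρ M i) := by
  have hc : (0 : ℂ) ≤ ((prob ρ M i : ℂ))⁻¹ := by
    rw [← Complex.ofReal_inv]
    exact_mod_cast inv_nonneg.mpr (M.prob_nonneg hρ i)
  refine ⟨(posSemidef_ptraceA (M.posSemidef_conj hρ i)).smul hc, ?_⟩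
  have htr : ((prob ρ M i : ℝ) : ℂ) = ((M.P i ⊗ₖ (1 : Matrix (Fin dB) (Fin dB) ℂ)) * ρ *
      (M.P i ⊗ₖ (1 : Matrix (Fin dB) (Fin dB) ℂ))).trace := by
    have h := (Complex.nonneg_iff.mp (M.posSemidef_conj hρ i).trace_nonneg).2
    apply Complex.ext
    · rw [Complex.ofReal_re, prob, trace_conj]
    · rw [Complex.ofReal_im, h]
  rw [condB, Matrix.trace_smul, trace_ptraceA, ← htr, smul_eq_mul, inv_mul_cancel₀]
  exact_mod_cast hi

end ProjMeas

theorem vnEntropy_nonneg {d : ℕ} {σ : Matrix (Fin d) (Fin d) ℂ} (hσ : IsDensityMatrix σ) :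
    0 ≤ vnEntropy σ := by
  have hH := hσ.1.isHermitian
  have hsum : ∑ k, hH.eigenvalues k = 1 := by
    have h := hH.trace_eq_sum_eigenvalues
    rw [hσ.2] at h
    apply Complex.ofReal_injective
    simpa using h.symm
  rw [vnEntropy, dif_pos hH, neg_nonneg]
  refine Finset.sum_nonpos fun k _ => ?_
  have h0 := hσ.1.eigenvalues_nonneg
  refine mul_nonpos_of_nonneg_of_nonpos (h0 k) (Real.log_nonpos (h0 k) ?_)
  rw [← hsum]
  exact Finset.single_le_sum (fun j _ => h0 j) (Finset.mem_univ k)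

theorem cHV_le_vnEntropy {ρ : Matrix (Fin dA × Fin dB) (Fin dA × Fin dB) ℂ} (hρ : ρ.PosSemidef)
    (M : ProjMeas dA m) : cHV ρ M ≤ vnEntropy (ptraceA ρ) := by
  refine sub_le_self _ (Finset.sum_nonneg fun i _ => ?_)
  rcases eq_or_ne (prob ρ M i) 0 with hi | hi
  · rw [hi, zero_mul]
  · exact mul_nonneg (M.prob_nonneg hρ i) (vnEntropy_nonneg (M.isDensityMatrix_condB hρ hi))

theorem cHV_le_CHV {ρ : Matrix (Fin dA × Fin dB) (Fin dA × Fin dB) ℂ} (hρ : ρ.PosSemidef)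
    {M : ProjMeas dA m} (hM : M.Complete) : cHV ρ M ≤ CHV ρ := by
  refine le_csSup ⟨vnEntropy (ptraceA ρ), ?_⟩ ⟨m, M, hM, rfl⟩
  rintro _ ⟨n, N, -, rfl⟩
  exact cHV_le_vnEntropy hρ N

end

/-- if a complete projective measurement attains `C_HV(ρ)`, then the
dephased state satisfies `C_HV(ρ') ≥ C_HV(ρ)`. -/
theorem CHV_dephAB_ge {dA dB m : ℕ}
    (ρ : Matrix (Fin dA × Fin dB) (Fin dA × Fin dB) ℂ) (hρ : IsDensityMatrix ρ)
    (M : ProjMeas dA m) (hM : M.Complete) (hopt : cHV ρ M = CHV ρ) :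
    CHV (dephAB ρ M) ≥ CHV ρ := by
  rw [ge_iff_le, ← hopt, ← M.cHV_dephAB ρ]
  exact cHV_le_CHV (M.posSemidef_dephAB hρ.1) hM

end
end

section
/- Let ρ_AB = (1 ⊗ Λ₁)(|ψ_AB⟩⟨ψ_AB|) be the explicit two-qubit state built from the channel Λ₁(σ) = A₁σA₁† + A₂σA₂†, A₁ = |0⟩⟨0| + (1/√2)|1⟩⟨1|, A₂ = (1/√2)|0⟩⟨1|, and |ψ_AB⟩ = (|0⟩⊗|ψ₀⟩ + |1⟩⊗|ψ₁⟩)/√2 with |ψ₀⟩ = (|0⟩+|1⟩)/√2 and |ψ₁⟩ = (4/5)|0⟩ + (3/5)|1⟩. Then Δ_cl^→(ρ_AB) < C_HV(ρ_AB). -/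
open Matrix Kronecker
open scoped ComplexOrder

noncomputable section

/-- The standard-basis projective measurement `{|i⟩⟨i|}` on `ℂ^d`. -/
def stdMeas (d : ℕ) : ProjMeas d d where
  P i := Matrix.diagonal fun j => if j = i then 1 else 0
  herm i := by
    rw [Matrix.isHermitian_diagonal_iff]
    intro j
    split <;> simp [_root_.IsSelfAdjoint]
  idem i := by
    ext a b
    rw [Matrix.diagonal_mul_diagonal]
    simp only [Matrix.diagonal_apply]
    split_ifs <;> simp_all
  orth i j hij := by
    rw [Matrix.diagonal_mul_diagonal]
    ext a b
    simp only [Matrix.diagonal_apply, Matrix.zero_apply]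
    split_ifs <;> simp_all
  sum_eq := by
    ext a b
    rw [Matrix.sum_apply]
    by_cases hab : a = b
    · subst hab
      simp [Matrix.diagonal_apply, Finset.sum_ite_eq']
    · simp [Matrix.diagonal_apply, hab, Matrix.one_apply]

/-- The Kraus operator `A₁ = |0⟩⟨0| + (1/√2)|1⟩⟨1|` of the channel `Λ₁`. -/
def A1 : Matrix (Fin 2) (Fin 2) ℂ := !![1, 0; 0, (Real.sqrt 2 : ℂ)⁻¹]

/-- The Kraus operator `A₂ = (1/√2)|0⟩⟨1|` of the channel `Λ₁`. -/
def A2 : Matrix (Fin 2) (Fin 2) ℂ := !![0, (Real.sqrt 2 : ℂ)⁻¹; 0, 0]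

/-- `|ψ₀⟩ = (|0⟩+|1⟩)/√2`. -/
def ψ0 : Fin 2 → ℂ := ![(Real.sqrt 2 : ℂ)⁻¹, (Real.sqrt 2 : ℂ)⁻¹]

/-- `|ψ₁⟩ = (4/5)|0⟩ + (3/5)|1⟩`. -/
def ψ1 : Fin 2 → ℂ := ![4/5, 3/5]

/-- `|ψ_AB⟩ = (|0⟩⊗|ψ₀⟩ + |1⟩⊗|ψ₁⟩)/√2`. -/
def ψSW : Fin 2 × Fin 2 → ℂ := fun x => (Real.sqrt 2 : ℂ)⁻¹ * (![ψ0, ψ1] x.1 x.2)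

/-- The Schumacher–Westmoreland state `ρ_AB = (1 ⊗ Λ₁)(|ψ_AB⟩⟨ψ_AB|)`. -/
def ρSW : Matrix (Fin 2 × Fin 2) (Fin 2 × Fin 2) ℂ :=
  ((1 : Matrix (Fin 2) (Fin 2) ℂ) ⊗ₖ A1) * outer ψSW *
      ((1 : Matrix (Fin 2) (Fin 2) ℂ) ⊗ₖ A1)ᴴ +
    ((1 : Matrix (Fin 2) (Fin 2) ℂ) ⊗ₖ A2) * outer ψSW *
      ((1 : Matrix (Fin 2) (Fin 2) ℂ) ⊗ₖ A2)ᴴ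

/-- The entropy of a trace-one Hermitian `2 × 2` matrix whose determinant is `x² / 4`. -/
def qubitEntropy (x : ℝ) : ℝ := Real.binEntropy ((1 - √(1 - x ^ 2)) / 2)

lemma continuous_qubitEntropy : Continuous qubitEntropy := by
  unfold qubitEntropy
  fun_prop

lemma two_mul_lt_log_one_add_sub_log_one_sub {r : ℝ} (h₀ : 0 < r) (h₁ : r < 1) :
    2 * r < Real.log (1 + r) - Real.log (1 - r) := by
  have h : 0 < 1 - r := by linarith
  have key := Real.lt_log_one_add_of_pos (x := 2 * r / (1 - r)) (by positivity)
  have e₁ : 2 * (2 * r / (1 - r)) / (2 * r / (1 - r) + 2) = 2 * r := by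
    have : 2 * r / (1 - r) + 2 = 2 / (1 - r) := by field_simp; ring
    rw [this]; field_simp
  have e₂ : 1 + 2 * r / (1 - r) = (1 + r) / (1 - r) := by field_simp; ring
  rwa [e₁, e₂, Real.log_div (by positivity) h.ne'] at key

lemma sqrt_one_sub_sq_mem_Ioo {x : ℝ} (hx : x ∈ Set.Ioo (0 : ℝ) 1) :
    √(1 - x ^ 2) ∈ Set.Ioo (0 : ℝ) 1 := by
  obtain ⟨h₀, h₁⟩ := hx
  refine ⟨Real.sqrt_pos.mpr (by nlinarith), ?_⟩
  rw [Real.sqrt_lt' one_pos]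
  nlinarith

lemma hasDerivAt_sqrt_one_sub_sq {x : ℝ} (hx : x ∈ Set.Ioo (0 : ℝ) 1) :
    HasDerivAt (fun x : ℝ => √(1 - x ^ 2)) (-x / √(1 - x ^ 2)) x := by
  have hr := Real.sqrt_pos.mp (sqrt_one_sub_sq_mem_Ioo hx).1
  have h : HasDerivAt (fun x : ℝ => 1 - x ^ 2) (-(2 * x)) x := by
    simpa using (hasDerivAt_pow 2 x).const_sub 1
  convert h.sqrt hr.ne' using 1
  field_simp

lemma hasDerivAt_qubitEntropy {x : ℝ} (hx : x ∈ Set.Ioo (0 : ℝ) 1) :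
    HasDerivAt qubitEntropy (x * (Real.log (1 + √(1 - x ^ 2)) - Real.log (1 - √(1 - x ^ 2))) /
      (2 * √(1 - x ^ 2))) x := by
  obtain ⟨h₀, h₁⟩ := sqrt_one_sub_sq_mem_Ioo hx
  have hin := ((hasDerivAt_sqrt_one_sub_sq hx).const_sub 1).div_const 2
  have hout := Real.hasDerivAt_binEntropy (p := (1 - √(1 - x ^ 2)) / 2)
    (by linarith) (by linarith)
  refine (hout.comp x hin).congr_deriv ?_
  have e : 1 - (1 - √(1 - x ^ 2)) / 2 = (1 + √(1 - x ^ 2)) / 2 := by ring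
  rw [e, Real.log_div (by linarith) two_ne_zero, Real.log_div (by linarith) two_ne_zero]
  field_simp
  ring

lemma deriv2_qubitEntropy {x : ℝ} (hx : x ∈ Set.Ioo (0 : ℝ) 1) :
    deriv^[2] qubitEntropy x =
      (Real.log (1 + √(1 - x ^ 2)) - Real.log (1 - √(1 - x ^ 2)) - 2 * √(1 - x ^ 2)) /
        (2 * √(1 - x ^ 2) ^ 3) := by
  obtain ⟨h₀, h₁⟩ := sqrt_one_sub_sq_mem_Ioo hx
  have hev : deriv qubitEntropy =ᶠ[nhds x] fun x =>
      x * (Real.log (1 + √(1 - x ^ 2)) - Real.log (1 - √(1 - x ^ 2))) / (2 * √(1 - x ^ 2)) := by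
    filter_upwards [Ioo_mem_nhds hx.1 hx.2] with y hy using (hasDerivAt_qubitEntropy hy).deriv
  have hr := hasDerivAt_sqrt_one_sub_sq hx
  have hlog := ((hr.const_add 1).log (by linarith)).sub ((hr.const_sub 1).log (by linarith))
  have hd := ((hasDerivAt_id' x).mul hlog).div (hr.const_mul 2) (by positivity)
  rw [Function.iterate_succ, Function.iterate_one, Function.comp_apply, hev.deriv_eq]
  refine hd.deriv.trans ?_
  have hsq : √(1 - x ^ 2) ^ 2 = 1 - x ^ 2 := Real.sq_sqrt (Real.sqrt_pos.mp h₀).le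
  simp only [Pi.sub_apply, Pi.mul_apply]
  generalize √(1 - x ^ 2) = r at *
  have hx2 : x ^ 2 = (1 + r) * (1 - r) := by linarith
  have h₂ : 1 - r ≠ 0 := by linarith
  have h₃ : 1 + r ≠ 0 := by linarith
  generalize Real.log (1 + r) = u at *
  generalize Real.log (1 - r) = v at *
  field_simp
  rw [hx2]
  ring

lemma strictConvexOn_qubitEntropy : StrictConvexOn ℝ (Set.Icc 0 1) qubitEntropy := by
  refine strictConvexOn_of_deriv2_pos (convex_Icc 0 1) continuous_qubitEntropy.continuousOn ?_
  intro x hx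
  rw [interior_Icc] at hx
  obtain ⟨h₀, h₁⟩ := sqrt_one_sub_sq_mem_Ioo hx
  rw [deriv2_qubitEntropy hx]
  have := two_mul_lt_log_one_add_sub_log_one_sub h₀ h₁
  exact div_pos (by linarith) (by positivity)

lemma vnEntropy_eq_binEntropy {A : Matrix (Fin 2) (Fin 2) ℂ} (hA : A.IsHermitian) {p : ℝ}
    (htr : A.trace = 1) (hdet : A.det = ((p * (1 - p) : ℝ) : ℂ)) :
    vnEntropy A = Real.binEntropy p := by
  rw [vnEntropy, dif_pos hA, Fin.sum_univ_two]
  rw [hA.trace_eq_sum_eigenvalues, Fin.sum_univ_two] at htr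
  rw [hA.det_eq_prod_eigenvalues, Fin.prod_univ_two] at hdet
  have h₁ : hA.eigenvalues 0 + hA.eigenvalues 1 = 1 := by
    apply Complex.ofReal_injective
    push_cast
    exact htr
  have h₂ : hA.eigenvalues 0 * hA.eigenvalues 1 = p * (1 - p) := by
    apply Complex.ofReal_injective
    rw [Complex.ofReal_mul]
    exact hdet
  generalize hA.eigenvalues 0 = a at *
  generalize hA.eigenvalues 1 = b at *
  obtain rfl : b = 1 - a := by linarith
  have hS : -(a * Real.log a + (1 - a) * Real.log (1 - a)) = Real.binEntropy a := by
    rw [Real.binEntropy_eq_negMulLog_add_negMulLog_one_sub]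
    simp only [Real.negMulLog]
    ring
  have h : (a - p) * (1 - a - p) = 0 := by linear_combination h₂
  rw [hS]
  rcases mul_eq_zero.mp h with h | h
  · rw [sub_eq_zero.mp h]
  · rw [← Real.binEntropy_one_sub, sub_eq_zero.mp h]

lemma vnEntropy_eq_qubitEntropy {A : Matrix (Fin 2) (Fin 2) ℂ} (hA : A.IsHermitian) {x : ℝ}
    (hx : x ^ 2 ≤ 1) (htr : A.trace = 1) (hdet : A.det = ((x ^ 2 / 4 : ℝ) : ℂ)) :
    vnEntropy A = qubitEntropy x := by
  refine vnEntropy_eq_binEntropy hA htr ?_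
  rw [hdet]
  congr 1
  linear_combination Real.sq_sqrt (sub_nonneg.mpr hx) / 4

/-- The matrix `(1 + x σₓ + y σ_y + z σ_z) / 2` with Bloch vector `(x, y, z)`. -/
def bloch (x y z : ℝ) : Matrix (Fin 2) (Fin 2) ℂ :=
  !![(1 + z) / 2, (x - y * Complex.I) / 2; (x + y * Complex.I) / 2, (1 - z) / 2]

lemma isHermitian_bloch (x y z : ℝ) : (bloch x y z).IsHermitian := by
  ext i j
  fin_cases i <;> fin_cases j <;> simp [bloch, sub_eq_add_neg]

lemma bloch_add_bloch_neg (x y z : ℝ) : bloch x y z + bloch (-x) (-y) (-z) = 1 := by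
  ext i j
  fin_cases i <;> fin_cases j <;> simp [bloch] <;> ring

lemma one_sub_bloch (x y z : ℝ) : 1 - bloch x y z = bloch (-x) (-y) (-z) := by
  rw [← bloch_add_bloch_neg x y z]
  abel

lemma bloch_mul_self {x y z : ℝ} (h : x ^ 2 + y ^ 2 + z ^ 2 = 1) :
    bloch x y z * bloch x y z = bloch x y z := by
  have h' : (x : ℂ) ^ 2 + y ^ 2 + z ^ 2 = 1 := by exact_mod_cast h
  ext i j
  fin_cases i <;> fin_cases j <;> simp [bloch, Matrix.mul_apply, Fin.sum_univ_two]
  · linear_combination h' / 4 - (y : ℂ) ^ 2 / 4 * Complex.I_sq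
  · ring
  · ring
  · linear_combination h' / 4 - (y : ℂ) ^ 2 / 4 * Complex.I_sq

lemma trace_bloch (x y z : ℝ) : (bloch x y z).trace = 1 := by
  simp [bloch, Matrix.trace_fin_two]
  ring

lemma det_bloch (x y z : ℝ) :
    (bloch x y z).det = (((1 - (x ^ 2 + y ^ 2 + z ^ 2)) / 4 : ℝ) : ℂ) := by
  simp [bloch, Matrix.det_fin_two]
  linear_combination (y : ℂ) ^ 2 / 4 * Complex.I_sq

lemma exists_eq_bloch {A : Matrix (Fin 2) (Fin 2) ℂ} (hA : A.IsHermitian) (htr : A.trace = 1) :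
    ∃ x y z : ℝ, A = bloch x y z := by
  refine ⟨2 * (A 1 0).re, 2 * (A 1 0).im, 2 * (A 0 0).re - 1, ?_⟩
  have h₀₀ := congrArg Complex.im (hA.apply 0 0)
  have h₀₁ := hA.apply 0 1
  rw [Matrix.trace_fin_two] at htr
  simp at h₀₀
  have h₀ : A 0 0 = (A 0 0).re := by
    apply Complex.ext <;> simp
    linarith
  ext i j
  fin_cases i <;> fin_cases j <;> simp [bloch]
  · exact h₀
  · rw [← h₀₁]
    apply Complex.ext <;> simp [neg_div]
  · apply Complex.ext <;> simp
  · linear_combination htr - h₀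

lemma mul_self_fin_two {R : Type*} [CommRing R] (A : Matrix (Fin 2) (Fin 2) R) :
    A * A = A.trace • A - A.det • (1 : Matrix (Fin 2) (Fin 2) R) := by
  ext i j
  fin_cases i <;> fin_cases j <;>
    simp [Matrix.mul_apply, Fin.sum_univ_two, Matrix.trace_fin_two, Matrix.det_fin_two] <;> ring

lemma Matrix.trace_eq_rank_of_isIdempotentElem {n K : Type*} [Fintype n] [DecidableEq n]
    [Field K] {P : Matrix n n K} (hP : IsIdempotentElem P) : P.trace = P.rank := by
  have h : IsIdempotentElem P.toLin' := by
    rw [IsIdempotentElem, Module.End.mul_eq_comp, ← Matrix.toLin'_mul, hP.eq]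
  rw [← Matrix.trace_toLin'_eq, (LinearMap.IsIdempotentElem.isProj_range _ h).trace, Matrix.rank,
    Matrix.toLin'_apply']

lemma exists_bloch_of_rank_one {P : Matrix (Fin 2) (Fin 2) ℂ} (hP : P.IsHermitian)
    (hid : P * P = P) (hr : P.rank = 1) :
    ∃ x y z : ℝ, x ^ 2 + y ^ 2 + z ^ 2 = 1 ∧ P = bloch x y z := by
  have htr : P.trace = 1 := by simp [Matrix.trace_eq_rank_of_isIdempotentElem hid, hr]
  have hdet : P.det = 0 := by
    have h := mul_self_fin_two P
    rw [hid, htr, one_smul, eq_comm, sub_eq_self] at h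
    simpa using congrFun (congrFun h 0) 0
  obtain ⟨x, y, z, rfl⟩ := exists_eq_bloch hP htr
  refine ⟨x, y, z, ?_, rfl⟩
  rw [det_bloch, Complex.ofReal_eq_zero] at hdet
  linarith

lemma rank_bloch {x y z : ℝ} (h : x ^ 2 + y ^ 2 + z ^ 2 = 1) : (bloch x y z).rank = 1 := by
  have := Matrix.trace_eq_rank_of_isIdempotentElem (bloch_mul_self h)
  rw [trace_bloch] at this
  exact_mod_cast this.symm

/-- The measurement along the Bloch axis `(x, y, z)`. -/
def blochMeas (x y z : ℝ) (h : x ^ 2 + y ^ 2 + z ^ 2 = 1) : ProjMeas 2 2 where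
  P := ![bloch x y z, bloch (-x) (-y) (-z)]
  herm i := by fin_cases i <;> exact isHermitian_bloch _ _ _
  idem i := by
    fin_cases i
    · exact bloch_mul_self h
    · exact bloch_mul_self (by simpa using h)
  orth i j hij := by
    have h' : (-x) ^ 2 + (-y) ^ 2 + (-z) ^ 2 = 1 := by simpa using h
    have e₁ := bloch_mul_self h
    have e₂ := bloch_mul_self h'
    have e := one_sub_bloch x y z
    fin_cases i <;> fin_cases j
    · exact absurd rfl hij
    · simp [← e, mul_sub, e₁]
    · simp [← e, sub_mul, e₁]
    · exact absurd rfl hij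
  sum_eq := by simpa using bloch_add_bloch_neg x y z

lemma complete_blochMeas {x y z : ℝ} (h : x ^ 2 + y ^ 2 + z ^ 2 = 1) :
    (blochMeas x y z h).Complete := by
  intro i
  fin_cases i
  · exact rank_bloch h
  · exact rank_bloch (by simpa using h)

lemma ProjMeas.Complete.card_eq_two {m : ℕ} {M : ProjMeas 2 m} (hM : M.Complete) : m = 2 := by
  have h : ∀ i, (M.P i).trace = 1 := fun i => by
    obtain ⟨x, y, z, -, h⟩ := exists_bloch_of_rank_one (M.herm i) (M.idem i) (hM i)
    rw [h, trace_bloch]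
  have := congrArg Matrix.trace M.sum_eq
  simp [Matrix.trace_sum, h] at this
  exact_mod_cast this

lemma ProjMeas.Complete.exists_bloch {M : ProjMeas 2 2} (hM : M.Complete) :
    ∃ x y z : ℝ, x ^ 2 + y ^ 2 + z ^ 2 = 1 ∧
      M.P 0 = bloch x y z ∧ M.P 1 = bloch (-x) (-y) (-z) := by
  obtain ⟨x, y, z, h, hP⟩ := exists_bloch_of_rank_one (M.herm 0) (M.idem 0) (hM 0)
  refine ⟨x, y, z, h, hP, ?_⟩
  have hs := M.sum_eq
  rw [Fin.sum_univ_two, hP] at hs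
  rw [← one_sub_bloch, ← hs, add_sub_cancel_left]

lemma ptraceA_sandwich (ρ : Matrix (Fin 2 × Fin 2) (Fin 2 × Fin 2) ℂ)
    {P : Matrix (Fin 2) (Fin 2) ℂ} (hP : P * P = P) :
    ∀ b b' : Fin 2, ptraceA ((P ⊗ₖ (1 : Matrix (Fin 2) (Fin 2) ℂ)) * ρ *
      (P ⊗ₖ (1 : Matrix (Fin 2) (Fin 2) ℂ))) b b' =
      P 0 0 * ρ (0, b) (0, b') + P 1 0 * ρ (0, b) (1, b') + P 0 1 * ρ (1, b) (0, b') +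
        P 1 1 * ρ (1, b) (1, b') := by
  have h : ∀ i j, P i 0 * P 0 j + P i 1 * P 1 j = P i j := fun i j => by
    have := congrFun (congrFun hP i) j
    rwa [Matrix.mul_apply, Fin.sum_univ_two] at this
  simp only [ptraceA, Matrix.of_apply, Matrix.mul_apply, Fintype.sum_prod_type,
    Fin.sum_univ_two, Matrix.kroneckerMap_apply, Fin.forall_fin_two, Matrix.one_apply_eq,
    Matrix.one_apply_ne zero_ne_one, Matrix.one_apply_ne one_ne_zero, mul_one, mul_zero,
    zero_mul, add_zero, zero_add]
  refine ⟨⟨?_, ?_⟩, ?_, ?_⟩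
  · linear_combination ρ (0, 0) (0, 0) * h 0 0 + ρ (0, 0) (1, 0) * h 1 0 +
      ρ (1, 0) (0, 0) * h 0 1 + ρ (1, 0) (1, 0) * h 1 1
  · linear_combination ρ (0, 0) (0, 1) * h 0 0 + ρ (0, 0) (1, 1) * h 1 0 +
      ρ (1, 0) (0, 1) * h 0 1 + ρ (1, 0) (1, 1) * h 1 1
  · linear_combination ρ (0, 1) (0, 0) * h 0 0 + ρ (0, 1) (1, 0) * h 1 0 +
      ρ (1, 1) (0, 0) * h 0 1 + ρ (1, 1) (1, 0) * h 1 1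
  · linear_combination ρ (0, 1) (0, 1) * h 0 0 + ρ (0, 1) (1, 1) * h 1 0 +
      ρ (1, 1) (0, 1) * h 0 1 + ρ (1, 1) (1, 1) * h 1 1

/-- The block `⟨a|ρSW|a'⟩`, an operator on Bob's system. -/
def ρSWBlock : Fin 2 → Fin 2 → Matrix (Fin 2) (Fin 2) ℝ :=
  ![![!![3 / 8, (√2)⁻¹ / 4; (√2)⁻¹ / 4, 1 / 8],
      !![11 / 20 * (√2)⁻¹, 3 / 20; 1 / 5, 3 / 20 * (√2)⁻¹]],
    ![!![11 / 20 * (√2)⁻¹, 1 / 5; 3 / 20, 3 / 20 * (√2)⁻¹],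
      !![41 / 100, 6 / 25 * (√2)⁻¹; 6 / 25 * (√2)⁻¹, 9 / 100]]]

lemma inv_sqrt_two_sq : ((√2)⁻¹ : ℝ) ^ 2 = 1 / 2 := by
  rw [inv_pow, Real.sq_sqrt zero_le_two, one_div]

lemma ρSW_apply : ∀ a b a' b' : Fin 2, ρSW (a, b) (a', b') = (ρSWBlock a a' b b' : ℂ) := by
  have h : ((√2 : ℝ) : ℂ)⁻¹ ^ 2 = 1 / 2 := by
    rw [← Complex.ofReal_inv, ← Complex.ofReal_pow, inv_sqrt_two_sq]
    norm_num
  have c3 : (starRingEnd ℂ) 3 = 3 := map_ofNat _ 3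
  have c4 : (starRingEnd ℂ) 4 = 4 := map_ofNat _ 4
  have c5 : (starRingEnd ℂ) 5 = 5 := map_ofNat _ 5
  simp [ρSW, ρSWBlock, A1, A2, ψSW, ψ0, ψ1, outer, Fin.forall_fin_two, Matrix.mul_apply,
    Fintype.sum_prod_type, Matrix.one_apply, c3, c4, c5]
  generalize ((√2 : ℝ) : ℂ)⁻¹ = q at *
  have h3 : q ^ 3 = q / 2 := by linear_combination q * h
  have h4 : q ^ 4 = 1 / 4 := by linear_combination (q ^ 2 + 1 / 2) * h
  have h5 : q ^ 5 = q / 4 := by linear_combination q * h4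
  have h6 : q ^ 6 = 1 / 8 := by linear_combination q ^ 2 * h4 + h / 4
  ring_nf
  simp only [h, h3, h4, h5, h6]
  refine ⟨⟨⟨⟨?_, ?_⟩, ?_, ?_⟩, ⟨?_, trivial⟩, ?_, ?_⟩, ⟨⟨?_, ?_⟩, ?_, ?_⟩, ?_, ?_, ?_⟩ <;> ring

/-- Bob's unnormalised state after Alice's outcome with Bloch vector `(x, y, z)`. -/
def bobState (x y z : ℝ) : Matrix (Fin 2) (Fin 2) ℂ :=
  let u : ℝ := 49 / 200 * (√2)⁻¹ + (√2)⁻¹ * z / 200 + 7 / 40 * x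
  !![((157 / 400 - 7 / 400 * z + 11 / 20 * (√2)⁻¹ * x : ℝ) : ℂ), u - (y / 40 : ℝ) * Complex.I;
    u + (y / 40 : ℝ) * Complex.I, ((43 / 400 + 7 / 400 * z + 3 / 20 * (√2)⁻¹ * x : ℝ) : ℂ)]

/-- The probability of an outcome whose Bloch vector has `σₓ`-component `x`. -/
def outcomeProb (x : ℝ) : ℝ := (1 + 7 / 5 * (√2)⁻¹ * x) / 2

/-- The weight `p_i ⟨1|σ_i|1⟩` of the state `σ_i` on Bob's side before the channel acts. -/
def excitedWeight (x z : ℝ) : ℝ := (43 / 100 + 7 / 100 * z + 3 / 5 * (√2)⁻¹ * x) / 2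

lemma ptraceA_sandwich_ρSW {x y z : ℝ} (h : x ^ 2 + y ^ 2 + z ^ 2 = 1) :
    ptraceA ((bloch x y z ⊗ₖ (1 : Matrix (Fin 2) (Fin 2) ℂ)) * ρSW *
      (bloch x y z ⊗ₖ (1 : Matrix (Fin 2) (Fin 2) ℂ))) = bobState x y z := by
  ext b b'
  rw [ptraceA_sandwich _ (bloch_mul_self h)]
  simp only [ρSW_apply]
  fin_cases b <;> fin_cases b' <;> simp [ρSWBlock, bobState, bloch] <;> ring

lemma isHermitian_bobState (x y z : ℝ) : (bobState x y z).IsHermitian := by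
  ext i j
  fin_cases i <;> fin_cases j <;> simp [bobState, sub_eq_add_neg]

lemma trace_bobState (x y z : ℝ) : (bobState x y z).trace = outcomeProb x := by
  simp [bobState, Matrix.trace_fin_two, outcomeProb]
  ring

lemma det_bobState {x y z : ℝ} (h : x ^ 2 + y ^ 2 + z ^ 2 = 1) :
    (bobState x y z).det = ((excitedWeight x z ^ 2 / 4 : ℝ) : ℂ) := by
  have hq : ((√2 : ℝ) : ℂ)⁻¹ ^ 2 = 1 / 2 := by
    rw [← Complex.ofReal_inv, ← Complex.ofReal_pow, inv_sqrt_two_sq]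
    norm_num
  have h' : (x : ℂ) ^ 2 + y ^ 2 + z ^ 2 = 1 := by exact_mod_cast h
  simp [bobState, Matrix.det_fin_two, excitedWeight]
  generalize ((√2 : ℝ) : ℂ)⁻¹ = q at *
  linear_combination (y : ℂ) ^ 2 / 1600 * Complex.I_sq - h' / 1600 +
    (11 / 20 * 3 / 20 * x ^ 2 - (49 / 200 + z / 200) ^ 2 - (3 / 20) ^ 2 * x ^ 2 : ℂ) * hq

lemma prob_ρSW {m : ℕ} {M : ProjMeas 2 m} {i : Fin m} {x y z : ℝ} (hM : M.P i = bloch x y z) :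
    prob ρSW M i = outcomeProb x := by
  have h : ((M.P i ⊗ₖ (1 : Matrix (Fin 2) (Fin 2) ℂ)) * ρSW).trace = (outcomeProb x : ℂ) := by
    simp [hM, Matrix.trace, Matrix.mul_apply, Fintype.sum_prod_type, Matrix.one_apply, ρSW_apply,
      ρSWBlock, bloch, outcomeProb]
    ring
  rw [prob, h, Complex.ofReal_re]

lemma inv_sqrt_two_lt_five_sevenths : ((√2)⁻¹ : ℝ) < 5 / 7 := by
  refine lt_of_pow_lt_pow_left₀ 2 (by norm_num) ?_
  rw [inv_sqrt_two_sq]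
  norm_num

lemma outcomeProb_pos {x : ℝ} (h : x ^ 2 ≤ 1) : 0 < outcomeProb x := by
  have hlt := inv_sqrt_two_lt_five_sevenths
  have hq : (0 : ℝ) < (√2)⁻¹ := by positivity
  have hx := (abs_le_of_sq_le_sq' (by simpa using h : x ^ 2 ≤ 1 ^ 2) zero_le_one).1
  unfold outcomeProb
  nlinarith [mul_nonneg hq.le (by linarith : (0 : ℝ) ≤ 1 + x)]

lemma excitedWeight_nonneg {x z : ℝ} (h : x ^ 2 + z ^ 2 ≤ 1) : 0 ≤ excitedWeight x z := by
  have hq := inv_sqrt_two_sq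
  unfold excitedWeight
  generalize (√2 : ℝ)⁻¹ = q at *
  have key : (7 / 100 * z + 3 / 5 * q * x) ^ 2 ≤ (43 / 100) ^ 2 := by
    have e : (7 / 100 * z + 3 / 5 * q * x) ^ 2 + (7 / 100 * x - 3 / 5 * q * z) ^ 2 =
        (43 / 100) ^ 2 * (x ^ 2 + z ^ 2) := by
      linear_combination (9 / 25 * (x ^ 2 + z ^ 2)) * hq
    nlinarith [sq_nonneg (7 / 100 * x - 3 / 5 * q * z)]
  have := (abs_le_of_sq_le_sq' key (by norm_num)).1
  linarith

lemma excitedWeight_le_outcomeProb {x z : ℝ} (h : x ^ 2 + z ^ 2 ≤ 1) :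
    excitedWeight x z ≤ outcomeProb x := by
  have hq := inv_sqrt_two_sq
  unfold excitedWeight outcomeProb
  generalize (√2 : ℝ)⁻¹ = q at *
  have key : (4 / 5 * q * x - 7 / 100 * z) ^ 2 ≤ (57 / 100) ^ 2 := by
    have e : (4 / 5 * q * x - 7 / 100 * z) ^ 2 + (4 / 5 * q * z + 7 / 100 * x) ^ 2 =
        (57 / 100) ^ 2 * (x ^ 2 + z ^ 2) := by
      linear_combination (16 / 25 * (x ^ 2 + z ^ 2)) * hq
    nlinarith [sq_nonneg (4 / 5 * q * z + 7 / 100 * x)]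
  have := (abs_le_of_sq_le_sq' key (by norm_num)).1
  linarith

lemma excitedWeight_div_outcomeProb_mem_Icc {x z : ℝ} (h : x ^ 2 + z ^ 2 ≤ 1) :
    excitedWeight x z / outcomeProb x ∈ Set.Icc (0 : ℝ) 1 := by
  have hp := outcomeProb_pos (x := x) (by nlinarith [sq_nonneg z])
  exact ⟨div_nonneg (excitedWeight_nonneg h) hp.le,
    (div_le_one hp).mpr (excitedWeight_le_outcomeProb h)⟩

lemma condB_ρSW {m : ℕ} {M : ProjMeas 2 m} {i : Fin m} {x y z : ℝ}
    (h : x ^ 2 + y ^ 2 + z ^ 2 = 1) (hM : M.P i = bloch x y z) :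
    condB ρSW M i = ((outcomeProb x : ℝ) : ℂ)⁻¹ • bobState x y z := by
  rw [condB, prob_ρSW hM, hM, ptraceA_sandwich_ρSW h]

lemma vnEntropy_condB_ρSW {m : ℕ} {M : ProjMeas 2 m} {i : Fin m} {x y z : ℝ}
    (h : x ^ 2 + y ^ 2 + z ^ 2 = 1) (hM : M.P i = bloch x y z) :
    vnEntropy (condB ρSW M i) = qubitEntropy (excitedWeight x z / outcomeProb x) := by
  have hp : (outcomeProb x : ℂ) ≠ 0 := by
    exact_mod_cast (outcomeProb_pos (by nlinarith [sq_nonneg y, sq_nonneg z])).ne'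
  rw [condB_ρSW h hM]
  have hmem := excitedWeight_div_outcomeProb_mem_Icc (x := x) (z := z) (by nlinarith [sq_nonneg y])
  refine vnEntropy_eq_qubitEntropy ?_ (pow_le_one₀ hmem.1 hmem.2) ?_ ?_
  · rw [← Complex.ofReal_inv]
    exact (isHermitian_bobState x y z).smul (Complex.conj_ofReal _)
  · rw [Matrix.trace_smul, trace_bobState, smul_eq_mul, inv_mul_cancel₀ hp]
  · rw [Matrix.det_smul, det_bobState h, Fintype.card_fin]
    push_cast
    ring

/-- The contribution of one measurement outcome to `∑ i, p_i S(ρ_i^B)`. -/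
def outcomeEntropy (x z : ℝ) : ℝ :=
  outcomeProb x * qubitEntropy (excitedWeight x z / outcomeProb x)

lemma cHV_ρSW {M : ProjMeas 2 2} {x y z : ℝ} (h : x ^ 2 + y ^ 2 + z ^ 2 = 1)
    (h0 : M.P 0 = bloch x y z) (h1 : M.P 1 = bloch (-x) (-y) (-z)) :
    cHV ρSW M = vnEntropy (ptraceA ρSW) - (outcomeEntropy x z + outcomeEntropy (-x) (-z)) := by
  rw [cHV, Fin.sum_univ_two, prob_ρSW h0, prob_ρSW h1, vnEntropy_condB_ρSW h h0,
    vnEntropy_condB_ρSW (by simpa using h) h1]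
  rfl

lemma ptraceB_ρSW : ptraceB ρSW = bloch (7 / 5 * (√2)⁻¹) 0 0 := by
  ext a a'
  simp only [ptraceB, Matrix.of_apply, Fin.sum_univ_two, ρSW_apply]
  fin_cases a <;> fin_cases a' <;> simp [ρSWBlock, bloch] <;> ring

lemma sum_bloch_mul_mul_bloch {x y z : ℝ} (c : ℝ) (h : x ^ 2 + y ^ 2 + z ^ 2 = 1) :
    bloch x y z * bloch c 0 0 * bloch x y z +
      bloch (-x) (-y) (-z) * bloch c 0 0 * bloch (-x) (-y) (-z) =
      bloch (c * x * x) (c * x * y) (c * x * z) := by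
  have h' : (x : ℂ) ^ 2 + y ^ 2 + z ^ 2 = 1 := by exact_mod_cast h
  ext i j
  fin_cases i <;> fin_cases j <;> simp [bloch]
  · linear_combination h' / 4 - (y : ℂ) ^ 2 / 4 * Complex.I_sq
  · linear_combination (c * y ^ 2 / 4 : ℂ) * Complex.I_sq - (c : ℂ) / 4 * h'
  · linear_combination (c * y ^ 2 / 4 : ℂ) * Complex.I_sq - (c : ℂ) / 4 * h'
  · linear_combination h' / 4 - (y : ℂ) ^ 2 / 4 * Complex.I_sq

lemma vnEntropy_ptraceB_ρSW : vnEntropy (ptraceB ρSW) = Real.binEntropy (outcomeProb 1) := by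
  rw [ptraceB_ρSW]
  refine vnEntropy_eq_binEntropy (isHermitian_bloch _ _ _) (trace_bloch _ _ _) ?_
  rw [det_bloch]
  congr 1
  unfold outcomeProb
  ring

lemma vnEntropy_deph_ρSW {M : ProjMeas 2 2} {x y z : ℝ} (h : x ^ 2 + y ^ 2 + z ^ 2 = 1)
    (h0 : M.P 0 = bloch x y z) (h1 : M.P 1 = bloch (-x) (-y) (-z)) :
    vnEntropy (deph (ptraceB ρSW) M) = Real.binEntropy (outcomeProb x) := by
  rw [deph, Fin.sum_univ_two, h0, h1, ptraceB_ρSW, sum_bloch_mul_mul_bloch _ h]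
  refine vnEntropy_eq_binEntropy (isHermitian_bloch _ _ _) (trace_bloch _ _ _) ?_
  rw [det_bloch]
  congr 1
  unfold outcomeProb
  linear_combination (-(7 / 5 * (√2)⁻¹ * x) ^ 2 / 4) * h

lemma outcomeProb_neg (x : ℝ) : outcomeProb (-x) = 1 - outcomeProb x := by
  unfold outcomeProb
  ring

lemma excitedWeight_neg (x z : ℝ) :
    excitedWeight (-x) (-z) = 43 / 100 - excitedWeight x z := by
  unfold excitedWeight
  ring

lemma binEntropy_outcomeProb_lt {x : ℝ} (hx : x ^ 2 < 1) :
    Real.binEntropy (outcomeProb 1) < Real.binEntropy (outcomeProb x) := by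
  have hq : (0 : ℝ) < (√2)⁻¹ := by positivity
  have hlt := inv_sqrt_two_lt_five_sevenths
  have hx1 := (sq_lt_one_iff_abs_lt_one x).mp hx
  have habs : Real.binEntropy (outcomeProb |x|) = Real.binEntropy (outcomeProb x) := by
    rcases abs_choice x with h | h <;> rw [h]
    rw [outcomeProb_neg, Real.binEntropy_one_sub]
  rw [← habs]
  have h0 := abs_nonneg x
  have hqx := mul_nonneg hq.le h0
  refine Real.binEntropy_strictAntiOn ⟨?_, ?_⟩ ⟨?_, ?_⟩ ?_ <;> unfold outcomeProb <;> nlinarith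

lemma qubitEntropy_le_outcomeEntropy_add {x z : ℝ} (h : x ^ 2 + z ^ 2 ≤ 1) :
    qubitEntropy (43 / 100) ≤ outcomeEntropy x z + outcomeEntropy (-x) (-z) := by
  have hp := outcomeProb_pos (x := x) (by nlinarith [sq_nonneg z])
  have hp' := outcomeProb_pos (x := -x) (by nlinarith [sq_nonneg z])
  have := strictConvexOn_qubitEntropy.convexOn.2 (excitedWeight_div_outcomeProb_mem_Icc h)
    (excitedWeight_div_outcomeProb_mem_Icc (x := -x) (z := -z) (by simpa using h))
    hp.le hp'.le (by rw [outcomeProb_neg]; ring)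
  simp only [smul_eq_mul] at this
  have hsum : excitedWeight x z + excitedWeight (-x) (-z) = 43 / 100 := by
    rw [excitedWeight_neg, add_sub_cancel]
  rw [mul_div_cancel₀ _ hp.ne', mul_div_cancel₀ _ hp'.ne', hsum] at this
  exact this

lemma qubitEntropy_lt_outcomeEntropy_add {x : ℝ} (h : x ^ 2 = 1) :
    qubitEntropy (43 / 100) < outcomeEntropy x 0 + outcomeEntropy (-x) (-0) := by
  have hp := outcomeProb_pos (x := x) h.le
  have hp' := outcomeProb_pos (x := -x) (by simpa using h.le)
  have hne : excitedWeight x 0 / outcomeProb x ≠ excitedWeight (-x) (-0) / outcomeProb (-x) := by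
    rw [Ne, div_eq_div_iff hp.ne' hp'.ne', excitedWeight_neg, outcomeProb_neg]
    intro he
    have hx : (√2)⁻¹ * x = 0 := by
      unfold excitedWeight outcomeProb at he
      linarith
    have := congrArg (· ^ 2) hx
    simp [mul_pow, h] at this
  have := strictConvexOn_qubitEntropy.2
    (excitedWeight_div_outcomeProb_mem_Icc (x := x) (z := 0) (by simpa using h.le))
    (excitedWeight_div_outcomeProb_mem_Icc (x := -x) (z := -0) (by simpa using h.le))
    hne hp hp' (by rw [outcomeProb_neg]; ring)
  simp only [smul_eq_mul] at this
  have hsum : excitedWeight x 0 + excitedWeight (-x) (-0) = 43 / 100 := by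
    rw [excitedWeight_neg, add_sub_cancel]
  rw [mul_div_cancel₀ _ hp.ne', mul_div_cancel₀ _ hp'.ne', hsum] at this
  exact this

/-- `δ_cl^→` of `ρSW`, up to the constant `S(ρ_B)`, for the measurement along the axis with
`σₓ`- and `σ_z`-components `v.1` and `v.2`. -/
def deficit (v : ℝ × ℝ) : ℝ :=
  Real.binEntropy (outcomeProb 1) - Real.binEntropy (outcomeProb v.1) -
    (outcomeEntropy v.1 v.2 + outcomeEntropy (-v.1) (-v.2))

lemma deficit_lt {v : ℝ × ℝ} (h : v.1 ^ 2 + v.2 ^ 2 ≤ 1) :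
    deficit v < -qubitEntropy (43 / 100) := by
  obtain ⟨x, z⟩ := v
  simp only at h
  unfold deficit
  rcases lt_or_ge (x ^ 2) 1 with hx | hx
  · linarith [binEntropy_outcomeProb_lt hx, qubitEntropy_le_outcomeEntropy_add h]
  · have hx1 : x ^ 2 = 1 := by nlinarith [sq_nonneg z]
    obtain rfl : z = 0 := by
      have : z ^ 2 = 0 := by nlinarith [sq_nonneg z]
      simpa using this
    have hle : Real.binEntropy (outcomeProb 1) = Real.binEntropy (outcomeProb x) := by
      rcases mul_self_eq_one_iff.mp (by nlinarith : x * x = 1) with rfl | rfl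
      · rfl
      · rw [outcomeProb_neg, Real.binEntropy_one_sub]
    have := qubitEntropy_lt_outcomeEntropy_add hx1
    simp only
    linarith

lemma continuousOn_deficit : ContinuousOn deficit {v | v.1 ^ 2 + v.2 ^ 2 ≤ 1} := by
  have hp : ∀ v ∈ {v : ℝ × ℝ | v.1 ^ 2 + v.2 ^ 2 ≤ 1}, v.1 ^ 2 ≤ 1 := fun v hv => by
    have : v.1 ^ 2 + v.2 ^ 2 ≤ 1 := hv
    nlinarith [sq_nonneg v.2]
  have hc : Continuous outcomeProb := by unfold outcomeProb; fun_prop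
  have hw : Continuous fun v : ℝ × ℝ => excitedWeight v.1 v.2 := by unfold excitedWeight; fun_prop
  have he : ContinuousOn (fun v : ℝ × ℝ => outcomeEntropy v.1 v.2)
      {v | v.1 ^ 2 + v.2 ^ 2 ≤ 1} :=
    (hc.comp continuous_fst).continuousOn.mul (continuous_qubitEntropy.comp_continuousOn
      (hw.continuousOn.div (hc.comp continuous_fst).continuousOn
        fun v hv => (outcomeProb_pos (hp v hv)).ne'))
  have he' : ContinuousOn (fun v : ℝ × ℝ => outcomeEntropy (-v.1) (-v.2))
      {v | v.1 ^ 2 + v.2 ^ 2 ≤ 1} :=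
    he.comp continuous_neg.continuousOn fun v hv => by simpa using hv
  exact (continuous_const.sub (Real.binEntropy_continuous.comp
    (hc.comp continuous_fst))).continuousOn.sub (he.add he')

lemma exists_forall_deficit_le :
    ∃ K < -qubitEntropy (43 / 100), ∀ v : ℝ × ℝ, v.1 ^ 2 + v.2 ^ 2 ≤ 1 → deficit v ≤ K := by
  have hcpt : IsCompact {v : ℝ × ℝ | v.1 ^ 2 + v.2 ^ 2 ≤ 1} := by
    refine (isCompact_Icc (a := ((-1, -1) : ℝ × ℝ)) (b := (1, 1))).of_isClosed_subset
      (isClosed_le (by fun_prop) continuous_const) ?_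
    intro v hv
    have hv : v.1 ^ 2 + v.2 ^ 2 ≤ 1 := hv
    have h₁ := abs_le_of_sq_le_sq' (by nlinarith [sq_nonneg v.2] : v.1 ^ 2 ≤ 1 ^ 2) zero_le_one
    have h₂ := abs_le_of_sq_le_sq' (by nlinarith [sq_nonneg v.1] : v.2 ^ 2 ≤ 1 ^ 2) zero_le_one
    exact ⟨⟨h₁.1, h₂.1⟩, ⟨h₁.2, h₂.2⟩⟩
  obtain ⟨v, hv, hmax⟩ := hcpt.exists_isMaxOn ⟨(0, 0), by simp⟩ continuousOn_deficit
  exact ⟨deficit v, deficit_lt hv, fun w hw => hmax hw⟩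

lemma deltaCl_ρSW {M : ProjMeas 2 2} {x y z : ℝ} (h : x ^ 2 + y ^ 2 + z ^ 2 = 1)
    (h0 : M.P 0 = bloch x y z) (h1 : M.P 1 = bloch (-x) (-y) (-z)) :
    deltaCl ρSW M = vnEntropy (ptraceA ρSW) + deficit (x, z) := by
  rw [deltaCl, cHV_ρSW h h0 h1, vnEntropy_ptraceB_ρSW, vnEntropy_deph_ρSW h h0 h1, deficit]
  ring

lemma cHV_ρSW_le {m : ℕ} {M : ProjMeas 2 m} (hM : M.Complete) :
    cHV ρSW M ≤ vnEntropy (ptraceA ρSW) - qubitEntropy (43 / 100) := by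
  obtain rfl := hM.card_eq_two
  obtain ⟨x, y, z, h, h0, h1⟩ := hM.exists_bloch
  rw [cHV_ρSW h h0 h1]
  linarith [qubitEntropy_le_outcomeEntropy_add (x := x) (z := z) (by nlinarith [sq_nonneg y])]

lemma cHV_blochMeas_σy (h : (0 : ℝ) ^ 2 + 1 ^ 2 + 0 ^ 2 = 1) :
    cHV ρSW (blochMeas 0 1 0 h) = vnEntropy (ptraceA ρSW) - qubitEntropy (43 / 100) := by
  rw [cHV_ρSW h rfl rfl]
  norm_num [outcomeEntropy, outcomeProb, excitedWeight]
  ring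

/-- for the Schumacher–Westmoreland state, the one-way classical
information deficit is strictly smaller than the Henderson–Vedral quantity. -/
theorem DeltaCl_lt_CHV_SW : DeltaCl ρSW < CHV ρSW := by
  obtain ⟨K, hK, hle⟩ := exists_forall_deficit_le
  have hy : (0 : ℝ) ^ 2 + 1 ^ 2 + 0 ^ 2 = 1 := by norm_num
  have hDelta : DeltaCl ρSW ≤ vnEntropy (ptraceA ρSW) + K := by
    refine csSup_le ⟨_, 2, blochMeas 0 1 0 hy, complete_blochMeas hy, rfl⟩ ?_
    rintro _ ⟨m, M, hM, rfl⟩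
    obtain rfl := hM.card_eq_two
    obtain ⟨x, y, z, h, h0, h1⟩ := hM.exists_bloch
    rw [deltaCl_ρSW h h0 h1]
    linarith [hle (x, z) (by nlinarith [sq_nonneg y])]
  have hC : vnEntropy (ptraceA ρSW) - qubitEntropy (43 / 100) ≤ CHV ρSW := by
    refine le_csSup ⟨vnEntropy (ptraceA ρSW) - qubitEntropy (43 / 100), ?_⟩
      ⟨2, blochMeas 0 1 0 hy, complete_blochMeas hy, (cHV_blochMeas_σy hy).symm⟩
    rintro _ ⟨m, M, hM, rfl⟩
    exact cHV_ρSW_le hM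
  linarith

end
end
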